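/- Let k be a field of characteristic 0 and n ≥ 1. Set J := [[0, Iₙ],[−Iₙ, 0]] ∈ Mat_{2n×2n}(k) and J' := [[0, I_{n+1}],[I_{n+1}, 0]] ∈ Mat_{(2n+2)×(2n+2)}(k); for w ∈ Mat_{(2n+2)×2n}(k) put w★ := J⁻¹·wᵀ·J' ∈ Mat_{2n×(2n+2)}(k), M(w) := w★·w and M'(w) := w·w★, and set 𝔰𝔭 := {X ∈ Mat_{2n×2n}(k) : XᵀJ + JX = 0} and 𝔰𝔬 := {X ∈ Mat_{(2n+2)×(2n+2)}(k) : XᵀJ' + J'X = 0}. Then there exists w such that the coefficient of z^n in the characteristic polynomial of Y ↦ M(w)·Y − Y·M(w) on 𝔰𝔭 is nonzero, and the coefficient of z^{n+1} in the characteristic polynomial of Y ↦ M'(w)·Y − Y·M'(w) on 𝔰𝔬 is nonzero. -/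

import Mathlib

open Matrix Polynomial

/-- The Lie algebra `𝔲(J) = {X | XᵀJ + JX = 0}` as a submodule of matrices. -/
def uSub (k : Type*) [Field k] {m : Type*} [Fintype m]
    (J : Matrix m m k) : Submodule k (Matrix m m k) where
  carrier := {X | Xᵀ * J + J * X = 0}
  zero_mem' := by simp
  add_mem' := by
    intro a b ha hb
    simp only [Set.mem_setOf_eq] at ha hb ⊢
    rw [Matrix.transpose_add, Matrix.add_mul, Matrix.mul_add]
    calc aᵀ * J + bᵀ * J + (J * a + J * b)
        = (aᵀ * J + J * a) + (bᵀ * J + J * b) := by abel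
      _ = 0 := by rw [ha, hb, add_zero]
  smul_mem' := by
    intro c X hX
    simp only [Set.mem_setOf_eq] at hX ⊢
    rw [Matrix.transpose_smul, Matrix.smul_mul, Matrix.mul_smul, ← smul_add, hX,
      smul_zero]

/-- The adjoint action `ad A : Y ↦ A·Y − Y·A` as a linear endomorphism of matrices. -/
noncomputable def adMat (k : Type*) [Field k] {m : Type*} [Fintype m]
    (A : Matrix m m k) : Matrix m m k →ₗ[k] Matrix m m k :=
  LinearMap.mulLeft k A - LinearMap.mulRight k A

/-- `J = [[0,Iₙ],[−Iₙ,0]]`, the symplectic form of `Sp(2n)`. -/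
def JSp (k : Type*) [Field k] (n : ℕ) : Matrix (Fin n ⊕ Fin n) (Fin n ⊕ Fin n) k :=
  Matrix.fromBlocks 0 1 (-1) 0

/-- `J' = [[0,I],[I,0]]`, the symmetric form of `O(2n+2)`. -/
def JO (k : Type*) [Field k] (n : ℕ) :
    Matrix (Fin (n+1) ⊕ Fin (n+1)) (Fin (n+1) ⊕ Fin (n+1)) k :=
  Matrix.fromBlocks 0 1 1 0

theorem adMat_diag_pow (k : Type*) [Field k] {m : Type*} [Fintype m] [DecidableEq m]
    (e : m → k) (U : Submodule k (Matrix m m k))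
    (h : ∀ Y ∈ U, adMat k (Matrix.diagonal e) Y ∈ U) (l : ℕ) (Y : U) (i j : m) :
    ((((adMat k (Matrix.diagonal e)).restrict h) ^ l) Y : Matrix m m k) i j
      = (e i - e j) ^ l * (Y : Matrix m m k) i j := by
  induction l generalizing Y with
  | zero => simp
  | succ l ih =>
    rw [pow_succ, Module.End.mul_apply, ih, LinearMap.restrict_coe_apply]
    simp only [adMat, LinearMap.sub_apply, LinearMap.mulLeft_apply, LinearMap.mulRight_apply,
      Matrix.sub_apply, Matrix.diagonal_mul, Matrix.mul_diagonal]
    ring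

theorem coeff_ne (k : Type*) [Field k] {p : Type*} [Fintype p] [DecidableEq p]
    (e : p ⊕ p → k) (U : Submodule k (Matrix (p ⊕ p) (p ⊕ p) k))
    (h : ∀ Y ∈ U, adMat k (Matrix.diagonal e) Y ∈ U)
    (H : ∀ Y, (Y ∈ U ∧ ∀ i j, e i ≠ e j → Y i j = 0) ↔
      ∃ a : p → k, Y = Matrix.diagonal (Sum.elim a (-a))) :
    ((adMat k (Matrix.diagonal e)).restrict h).charpoly.coeff (Fintype.card p) ≠ 0 := by
  set f : Module.End k U := (adMat k (Matrix.diagonal e)).restrict h with hf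
  have hfin : Module.finrank k (f.maxGenEigenspace 0) = Fintype.card p := by
    let φ : (p → k) →ₗ[k] U :=
      { toFun := fun a => ⟨Matrix.diagonal (Sum.elim a (-a)), ((H _).2 ⟨a, rfl⟩).1⟩
        map_add' := by
          intro a b
          ext i j
          rcases i with i | i <;> rcases j with j | j <;>
            simp [Matrix.diagonal_apply] <;> split_ifs <;> simp [add_comm]
        map_smul' := by
          intro c a
          ext i j
          rcases i with i | i <;> rcases j with j | j <;>
            simp [Matrix.diagonal_apply] }
    have hφ : Function.Injective φ := by
      intro a b hab
      funext i
      have := congrArg (fun Y : U => (Y : Matrix (p ⊕ p) (p ⊕ p) k) (Sum.inl i) (Sum.inl i)) hab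
      simpa [φ] using this
    have hz : f - (0 : k) • (1 : Module.End k U) = f := by
      rw [zero_smul]
      exact sub_zero f
    have hr : f.maxGenEigenspace 0 = LinearMap.range φ := by
      ext Y
      rw [Module.End.mem_maxGenEigenspace]
      constructor
      · rintro ⟨l, hl⟩
        obtain ⟨a, ha⟩ := (H (Y : Matrix (p ⊕ p) (p ⊕ p) k)).1 ⟨Y.2, by
          intro i j hij
          have h1 := adMat_diag_pow k e U h l Y i j
          rw [hz] at hl
          rw [← hf, hl] at h1
          have h2 : (e i - e j) ^ l ≠ 0 := pow_ne_zero _ (sub_ne_zero.2 hij)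
          simpa [h2] using h1.symm⟩
        exact ⟨a, Subtype.ext ha.symm⟩
      · rintro ⟨a, rfl⟩
        refine ⟨1, ?_⟩
        rw [hz]
        ext i j
        rw [hf, adMat_diag_pow]
        have h1 := ((H (φ a : Matrix (p ⊕ p) (p ⊕ p) k)).2 ⟨a, rfl⟩).2 i j
        by_cases hij : e i = e j
        · simp [hij]
        · simp [h1 hij]
    rw [hr, LinearMap.finrank_range_of_inj hφ, Module.finrank_fintype_fun_eq_card]
  rw [← hfin, LinearMap.finrank_maxGenEigenspace_zero_eq]
  have : f.charpoly ≠ 0 := f.charpoly_monic.ne_zero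
  exact Polynomial.trailingCoeff_nonzero_iff_nonzero.2 this

theorem ad_mem (k : Type*) [Field k] {m : Type*} [Fintype m] (J X : Matrix m m k)
    (hX : X ∈ uSub k J) : ∀ Y ∈ uSub k J, adMat k X Y ∈ uSub k J := by
  intro Y hY
  have hX' : Xᵀ * J = - (J * X) := eq_neg_of_add_eq_zero_left hX
  have hY' : Yᵀ * J = - (J * Y) := eq_neg_of_add_eq_zero_left hY
  change (X * Y - Y * X)ᵀ * J + J * (X * Y - Y * X) = 0
  rw [Matrix.transpose_sub, Matrix.transpose_mul, Matrix.transpose_mul, Matrix.sub_mul,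
    Matrix.mul_assoc, Matrix.mul_assoc, hX', hY', Matrix.mul_neg, Matrix.mul_neg,
    ← Matrix.mul_assoc, ← Matrix.mul_assoc, hX', hY', Matrix.mul_sub]
  simp only [Matrix.neg_mul, Matrix.mul_assoc]
  abel

theorem mem_uSub_blocks (k : Type*) [Field k] {p : Type*} [Fintype p] [DecidableEq p] (ε : k)
    (Y : Matrix (p ⊕ p) (p ⊕ p) k) :
    Y ∈ uSub k (Matrix.fromBlocks 0 1 (ε • (1 : Matrix p p k)) 0) ↔
      (∀ i j, ε * Y (Sum.inr j) (Sum.inl i) + Y (Sum.inr i) (Sum.inl j) = 0) ∧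
      (∀ i j, Y (Sum.inl j) (Sum.inl i) + Y (Sum.inr i) (Sum.inr j) = 0) ∧
      (∀ i j, ε * Y (Sum.inr j) (Sum.inr i) + ε * Y (Sum.inl i) (Sum.inl j) = 0) ∧
      (∀ i j, Y (Sum.inl j) (Sum.inr i) + ε * Y (Sum.inl i) (Sum.inr j) = 0) := by
  change Yᵀ * _ + _ * Y = 0 ↔ _
  conv_lhs => rw [← Matrix.fromBlocks_toBlocks Y, Matrix.fromBlocks_transpose,
    Matrix.fromBlocks_multiply, Matrix.fromBlocks_multiply, Matrix.fromBlocks_add,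
    ← Matrix.fromBlocks_zero, Matrix.fromBlocks_inj]
  simp [← Matrix.ext_iff, Matrix.toBlocks₁₁, Matrix.toBlocks₁₂, Matrix.toBlocks₂₁,
    Matrix.toBlocks₂₂]

theorem H_gen (k : Type*) [Field k] {p : Type*} [Fintype p] [DecidableEq p] (ε : k)
    (d : p → k) (hd : Function.Injective d)
    (hs : ∀ i j, d i + d j = 0 → i = j ∧ 1 + ε ≠ 0)
    (Y : Matrix (p ⊕ p) (p ⊕ p) k) :
    (Y ∈ uSub k (Matrix.fromBlocks 0 1 (ε • (1 : Matrix p p k)) 0) ∧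
      ∀ i j, Sum.elim (-d) d i ≠ Sum.elim (-d) d j → Y i j = 0) ↔
      ∃ a : p → k, Y = Matrix.diagonal (Sum.elim a (-a)) := by
  rw [mem_uSub_blocks]
  constructor
  · rintro ⟨⟨h1, h2, -, h4⟩, h⟩
    refine ⟨fun i => Y (Sum.inl i) (Sum.inl i), ?_⟩
    ext i j
    rcases i with i | i <;> rcases j with j | j
    · by_cases hij : i = j
      · subst hij; simp
      · simp only [Matrix.diagonal_apply, Sum.inl.injEq, hij, if_false]
        exact h _ _ (by simpa using fun h => hij (hd h))
    · simp only [Matrix.diagonal_apply, reduceCtorEq, if_false]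
      by_cases hz : d i + d j = 0
      · obtain ⟨rfl, hε⟩ := hs i j hz
        have := h4 i i
        have h5 : (1 + ε) * Y (Sum.inl i) (Sum.inr i) = 0 := by linear_combination this
        exact (mul_eq_zero.1 h5).resolve_left hε
      · refine h _ _ fun h => hz ?_
        simp only [Sum.elim_inl, Sum.elim_inr, Pi.neg_apply] at h
        linear_combination -h
    · simp only [Matrix.diagonal_apply, reduceCtorEq, if_false]
      by_cases hz : d i + d j = 0
      · obtain ⟨rfl, hε⟩ := hs i j hz
        have := h1 i i
        have h5 : (1 + ε) * Y (Sum.inr i) (Sum.inl i) = 0 := by linear_combination this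
        exact (mul_eq_zero.1 h5).resolve_left hε
      · refine h _ _ fun h => hz ?_
        simp only [Sum.elim_inl, Sum.elim_inr, Pi.neg_apply] at h
        linear_combination h
    · by_cases hij : i = j
      · subst hij
        simpa using eq_neg_of_add_eq_zero_right (h2 i i)
      · simp only [Matrix.diagonal_apply, Sum.inr.injEq, hij, if_false]
        exact h _ _ (by simpa using fun h => hij (hd h))
  · rintro ⟨a, rfl⟩
    refine ⟨⟨?_, ?_, ?_, ?_⟩, ?_⟩
    · intro i j; simp
    · intro i j
      by_cases hij : i = j
      · subst hij; simp
      · simp [Matrix.diagonal_apply, hij, Ne.symm hij]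
    · intro i j
      by_cases hij : i = j
      · subst hij; simp
      · simp [Matrix.diagonal_apply, hij, Ne.symm hij]
    · intro i j; simp
    · intro i j hij
      exact Matrix.diagonal_apply_ne _ (fun h => hij (by rw [h]))

theorem final_gen (k : Type*) [Field k] {p : Type*} [Fintype p] [DecidableEq p] (ε : k)
    (d : p → k) (hd : Function.Injective d)
    (hs : ∀ i j, d i + d j = 0 → i = j ∧ 1 + ε ≠ 0)
    (J M : Matrix (p ⊕ p) (p ⊕ p) k)
    (hJ : J = Matrix.fromBlocks 0 1 (ε • (1 : Matrix p p k)) 0)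
    (hM : M = Matrix.diagonal (Sum.elim (-d) d)) :
    ∃ h : ∀ Y ∈ uSub k J, adMat k M Y ∈ uSub k J,
      ((adMat k M).restrict h).charpoly.coeff (Fintype.card p) ≠ 0 := by
  subst hJ hM
  have H := H_gen k ε d hd hs
  have h := ad_mem k _ _ ((H (Matrix.diagonal (Sum.elim (-d) d))).2 ⟨-d, by simp⟩).1
  exact ⟨h, coeff_ne k _ _ h H⟩

theorem JSp_inv (k : Type*) [Field k] (n : ℕ) :
    (JSp k n)⁻¹ = Matrix.fromBlocks 0 (-1) 1 0 := by
  apply Matrix.inv_eq_right_inv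
  simp [JSp, Matrix.fromBlocks_multiply]

/-- For the dual pair `(Sp(2n), O(2n+2))` there is a
`w ∈ Mat_{(2n+2)×2n}` whose moment-map images `M(w) = w★w ∈ 𝔰𝔭(2n)` and
`M'(w) = ww★ ∈ 𝔰𝔬(2n+2)` are both regular semisimple, i.e. the coefficient of `zⁿ`
(resp. `z^{n+1}`) in the characteristic polynomial of `ad M(w)` on `𝔰𝔭` (resp. of
`ad M'(w)` on `𝔰𝔬`) is nonzero. Here `w★ = J⁻¹wᵀJ'`. -/
theorem stmt_10 (k : Type*) [Field k] [CharZero k] (n : ℕ) (hn : 1 ≤ n) :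
    ∃ w : Matrix (Fin (n+1) ⊕ Fin (n+1)) (Fin n ⊕ Fin n) k,
      ∃ (hM : ∀ Y ∈ uSub k (JSp k n),
            adMat k (((JSp k n)⁻¹ * wᵀ * JO k n) * w) Y ∈ uSub k (JSp k n))
        (hM' : ∀ Y ∈ uSub k (JO k n),
            adMat k (w * ((JSp k n)⁻¹ * wᵀ * JO k n)) Y ∈ uSub k (JO k n)),
        ((adMat k (((JSp k n)⁻¹ * wᵀ * JO k n) * w)).restrict hM).charpoly.coeff n ≠ 0 ∧
        ((adMat k (w * ((JSp k n)⁻¹ * wᵀ * JO k n))).restrict hM').charpoly.coeff (n+1)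
          ≠ 0 := by
  let A : Matrix (Fin (n+1)) (Fin n) k := Matrix.of fun i j => if i = j.castSucc then 1 else 0
  let d : Fin (n+1) → k := fun i => ((n - (i : ℕ) : ℕ) : k)
  let B : Matrix (Fin (n+1)) (Fin n) k := Matrix.diagonal d * A
  have hd : Function.Injective d := by
    intro i j hij
    have : n - (i : ℕ) = n - (j : ℕ) := by
      simp only [d] at hij
      exact_mod_cast hij
    ext
    omega
  have hs : ∀ i j, d i + d j = 0 → i = Fin.last n ∧ j = Fin.last n := by
    intro i j hij
    have : (n - (i : ℕ)) + (n - (j : ℕ)) = 0 := by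
      simp only [d] at hij
      exact_mod_cast hij
    refine ⟨?_, ?_⟩ <;> ext <;> simp <;> omega
  have hAB : Aᵀ * B = Matrix.diagonal (d ∘ Fin.castSucc) := by
    ext i j
    by_cases hij : i = j
    · subst hij
      simp [A, B, Matrix.mul_apply]
    · simp [A, B, Matrix.mul_apply, hij, Ne.symm hij]
  have hAA : B * Aᵀ = Matrix.diagonal d := by
    ext i j
    refine Fin.lastCases ?_ (fun i => ?_) i
    · simp [A, B, Matrix.mul_apply, Matrix.diagonal_apply, d]
    · rw [Matrix.mul_apply, Finset.sum_eq_single i]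
      · simp [A, B, Matrix.diagonal_apply, eq_comm]
      · intro b _ hb
        simp [A, B, Ne.symm hb]
      · simp
  have hBA : Bᵀ * A = Matrix.diagonal (d ∘ Fin.castSucc) := by
    have := congrArg Matrix.transpose hAB
    simpa [Matrix.transpose_mul] using this
  have hAA' : A * Bᵀ = Matrix.diagonal d := by
    have := congrArg Matrix.transpose hAA
    simpa [Matrix.transpose_mul] using this
  let w : Matrix (Fin (n+1) ⊕ Fin (n+1)) (Fin n ⊕ Fin n) k := Matrix.fromBlocks A 0 0 B
  have hst : (JSp k n)⁻¹ * wᵀ * JO k n = Matrix.fromBlocks (-Bᵀ) 0 0 Aᵀ := by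
    rw [JSp_inv]
    simp [w, JO, Matrix.fromBlocks_multiply, Matrix.fromBlocks_transpose]
  have e1 : ((JSp k n)⁻¹ * wᵀ * JO k n) * w
      = Matrix.diagonal (Sum.elim (-(d ∘ Fin.castSucc)) (d ∘ Fin.castSucc)) := by
    rw [hst]
    simp only [w, Matrix.fromBlocks_multiply, Matrix.neg_mul, hBA, hAB]
    simp [← Matrix.fromBlocks_diagonal, Matrix.diagonal_neg]
  have e2 : w * ((JSp k n)⁻¹ * wᵀ * JO k n) = Matrix.diagonal (Sum.elim (-d) d) := by
    rw [hst]
    simp only [w, Matrix.fromBlocks_multiply, Matrix.mul_neg, hAA, hAA']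
    simp [← Matrix.fromBlocks_diagonal, Matrix.diagonal_neg]
  obtain ⟨h1, h1'⟩ := final_gen k (-1) (d ∘ Fin.castSucc)
    (hd.comp (Fin.castSucc_injective n))
    (fun i j hij => absurd (hs _ _ hij).1 (Fin.castSucc_lt_last i).ne)
    (JSp k n) _ (by simp [JSp]) e1
  obtain ⟨h2, h2'⟩ := final_gen k 1 d hd
    (fun i j hij => ⟨(hs _ _ hij).1.trans (hs _ _ hij).2.symm, by norm_num⟩)
    (JO k n) _ (by simp [JO]) e2
  rw [Fintype.card_fin] at h1' h2'
  exact ⟨w, h1, h2, h1', h2'⟩
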